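/- arXiv:2108.07423 — 4 statements merged into one kernel-verified Lean document; each statement's English description precedes it below -/
import Mathlib

section
/- Let λ > 0, N ≥ 1, and let 0 = t₀ < t₁ < ... < t_N = T be real numbers, with Δᵢ = tᵢ − t_{i−1} for i = 1,...,N. Define a sequence by ν₀ = ω₀ ∈ ℝ and νᵢ = (ν_{i−1} + π)·exp(−λΔᵢ) for i = 1,...,N. Then ν_N = ω₀·exp(−λT) + π·exp(−λT)·(1 + Σ_{i=1}^{N−1} exp(λtᵢ)). -/
open Finset

/-- Closed form of a recursion that adds the constant `c` at each time `t i` and then decays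
exponentially with rate `r` until `t (i + 1)`. -/
theorem jump_decay_closed_form (r c : ℝ) (t ν : ℕ → ℝ) (n : ℕ)
    (hν : ∀ i < n, ν (i + 1) = (ν i + c) * Real.exp (-(r * (t (i + 1) - t i)))) :
    ν n = Real.exp (-(r * t n)) *
      (ν 0 * Real.exp (r * t 0) + c * ∑ i ∈ range n, Real.exp (r * t i)) := by
  induction n with
  | zero => simp [mul_left_comm, ← Real.exp_add]
  | succ n ih =>
    have hsplit : Real.exp (-(r * (t (n + 1) - t n))) =
        Real.exp (-(r * t (n + 1))) * Real.exp (r * t n) := by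
      rw [← Real.exp_add]; ring_nf
    have hcancel : Real.exp (-(r * t n)) * Real.exp (r * t n) = 1 := by
      simp [← Real.exp_add]
    rw [hν n n.lt_succ_self, ih fun i hi => hν i (hi.trans n.lt_succ_self), hsplit,
      sum_range_succ]
    linear_combination Real.exp (-(r * t (n + 1))) *
      (ν 0 * Real.exp (r * t 0) + c * ∑ i ∈ range n, Real.exp (r * t i)) * hcancel

/-- Composing `N` fast-slow events (jump of `+π` at each zero crossing
`t₀ = 0 < t₁ < ⋯ < t_N = T` of the input, followed by exponential decay of rate `λ`
until the next crossing) yields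
`ν_N = ω₀ exp (-λ T) + π exp (-λ T) (1 + ∑_{i=1}^{N-1} exp (λ tᵢ))`. -/
theorem composition_of_fast_slow_events
    (lam T ω₀ : ℝ) (hlam : 0 < lam) (N : ℕ) (hN : 1 ≤ N)
    (t : ℕ → ℝ) (ht0 : t 0 = 0) (htN : t N = T)
    (hmono : ∀ i < N, t i < t (i + 1))
    (ν : ℕ → ℝ) (hν0 : ν 0 = ω₀)
    (hν : ∀ i < N, ν (i + 1) = (ν i + Real.pi) * Real.exp (-(lam * (t (i + 1) - t i)))) :
    ν N = ω₀ * Real.exp (-(lam * T)) +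
      Real.pi * Real.exp (-(lam * T)) *
        (1 + ∑ i ∈ range (N - 1), Real.exp (lam * t (i + 1))) := by
  obtain ⟨n, rfl⟩ := Nat.exists_eq_add_of_le' hN
  rw [jump_decay_closed_form lam Real.pi t ν (n + 1) hν, sum_range_succ', ht0, htN, hν0,
    Nat.add_sub_cancel, mul_zero, Real.exp_zero]
  ring
end

section
/- Let k ∈ ℤ, Ω ∈ ℝ, α ∈ ℝ and I ∈ ℝ, and define f(ω) = −sin(Ω + ω)·(I − α·cos(Ω + ω)). Then the derivative of f at ω = kπ − Ω equals α − (−1)^k·I. In particular this derivative is negative if and only if α < (−1)^k·I, so the critical manifold {Ω + ω = kπ} of the single adaptive oscillator with negative feedback is attracting exactly when α < (−1)^k·I(θ) and repelling exactly when α > (−1)^k·I(θ). -/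
/-- For the single adaptive oscillator with negative feedback, the
transverse eigenvalue of the fast dynamics on the critical manifold `{Ω + ω = kπ}` is
`deriv f (kπ - Ω) = α - (-1)^k I` where
`f ω = -sin (Ω + ω) (I - α cos (Ω + ω))`; it is negative iff `α < (-1)^k I`
(attracting manifold) and positive iff `α > (-1)^k I` (repelling manifold). -/
theorem feedback_critical_manifold_transverse_eigenvalue
    (k : ℤ) (Ω α I : ℝ)
    (f : ℝ → ℝ)
    (hf : ∀ ω, f ω = -Real.sin (Ω + ω) * (I - α * Real.cos (Ω + ω))) :
    deriv f (k * Real.pi - Ω) = α - (-1 : ℝ) ^ k * I ∧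
    (deriv f (k * Real.pi - Ω) < 0 ↔ α < (-1 : ℝ) ^ k * I) ∧
    (0 < deriv f (k * Real.pi - Ω) ↔ (-1 : ℝ) ^ k * I < α) := by
  have hd : HasDerivAt f (α - (-1 : ℝ) ^ k * I) (k * Real.pi - Ω) := by
    have hφ : Ω + (k * Real.pi - Ω) = k * Real.pi := by ring
    have hadd : HasDerivAt (fun ω : ℝ => Ω + ω) 1 (k * Real.pi - Ω) :=
      (hasDerivAt_id _).const_add Ω
    have hprod := hadd.sin.fun_neg.fun_mul ((hadd.cos.const_mul α).const_sub I)
    have hsq : ((-1 : ℝ) ^ k) * (-1 : ℝ) ^ k = 1 := by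
      rw [← mul_zpow]
      norm_num
    rw [hφ, Real.sin_int_mul_pi, Real.cos_int_mul_pi] at hprod
    rw [funext hf]
    refine hprod.congr_deriv ?_
    linear_combination α * hsq
  rw [hd.deriv]
  exact ⟨rfl, sub_neg, sub_pos⟩
end

section
/- Let N ≥ 1, let Ω ∈ ℝ^N, α ∈ ℝ^N, I ∈ ℝ, and k ∈ ℤ^N, and define the vector field f : ℝ^N → ℝ^N by f_i(ω) = −sin(Ω_i + ω_i)·(I − Σ_{j=1}^{N} α_j·cos(Ω_j + ω_j)). Then the Jacobian matrix of f at the point ω* with ω*_i = k_iπ − Ω_i for all i is diagonal, with i-th diagonal entry equal to (−1)^{k_i+1}·I + Σ_{j=1}^{N} (−1)^{k_i + k_j}·α_j = α_i + (−1)^{k_i+1}·I + Σ_{j≠i} (−1)^{k_i + k_j}·α_j. -/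
open Finset

/-- At a point where every phase `Ω_i + ω_i` is a multiple of `π`, the sine factor vanishes, so
only its derivative contributes to the partial derivative in the `j`-th direction. -/
theorem hasDerivAt_pool_update {ι : Type*} [Fintype ι] [DecidableEq ι]
    (Ω α : ι → ℝ) (I : ℝ) (k : ι → ℤ) (ω : ι → ℝ)
    (hω : ∀ i, Ω i + ω i = k i * Real.pi) (i j : ι) :
    HasDerivAt (fun x : ℝ => -Real.sin (Ω i + Function.update ω j x i) *
        (I - ∑ l, α l * Real.cos (Ω l + Function.update ω j x l)))
      (-((-1 : ℝ) ^ k i * Pi.single (M := fun _ => ℝ) j 1 i) * (I - ∑ l, α l * (-1 : ℝ) ^ k l))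
      (ω j) := by
  have hupd (l : ι) : HasDerivAt (fun x : ℝ => Function.update ω j x l)
      (Pi.single (M := fun _ => ℝ) j 1 l) (ω j) :=
    hasDerivAt_pi.1 (hasDerivAt_update ω j (ω j)) l
  have hsin := ((hupd i).const_add (Ω i)).sin.neg
  have hfeedback := (HasDerivAt.fun_sum (u := univ) fun l _ =>
    ((hupd l).const_add (Ω l)).cos.const_mul (α l)).const_sub I
  refine (hsin.mul hfeedback).congr_deriv ?_
  simp [hω, Real.cos_int_mul_pi, Real.sin_int_mul_pi]

/-- For the pool of `N` adaptive frequency oscillators with negative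
mean-field feedback, the Jacobian of the fast vector field
`f_i ω = -sin (Ω_i + ω_i) (I - ∑_j α_j cos (Ω_j + ω_j))` at the point `ω*` of the
critical manifold `M_π` (where `ω*_i = k_i π - Ω_i`) is diagonal, with `i`-th diagonal
entry `(-1)^(k_i+1) I + ∑_j (-1)^(k_i + k_j) α_j
= α_i + (-1)^(k_i+1) I + ∑_{j ≠ i} (-1)^(k_i + k_j) α_j`. -/
theorem pool_jacobian_diagonal_on_Mpi
    (N : ℕ) (hN : 1 ≤ N)
    (Ω α : Fin N → ℝ) (I : ℝ) (k : Fin N → ℤ)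
    (f : (Fin N → ℝ) → Fin N → ℝ)
    (hf : ∀ ω i, f ω i =
      -Real.sin (Ω i + ω i) * (I - ∑ j, α j * Real.cos (Ω j + ω j)))
    (ωstar : Fin N → ℝ) (hωstar : ∀ i, ωstar i = k i * Real.pi - Ω i) :
    (∀ i j : Fin N,
      deriv (fun x : ℝ => f (Function.update ωstar j x) i) (ωstar j) =
        if i = j then
          (-1 : ℝ) ^ (k i + 1) * I + ∑ j', (-1 : ℝ) ^ (k i + k j') * α j'
        else 0) ∧
    (∀ i : Fin N,
      (-1 : ℝ) ^ (k i + 1) * I + ∑ j', (-1 : ℝ) ^ (k i + k j') * α j' =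
        α i + (-1 : ℝ) ^ (k i + 1) * I +
          ∑ j' ∈ univ.erase i, (-1 : ℝ) ^ (k i + k j') * α j') := by
  have hphase (i : Fin N) : Ω i + ωstar i = k i * Real.pi := by rw [hωstar]; ring
  have hneg : (-1 : ℝ) ≠ 0 := by norm_num
  refine ⟨fun i j => ?_, fun i => ?_⟩
  · simp only [hf]
    rw [(hasDerivAt_pool_update Ω α I k ωstar hphase i j).deriv]
    split_ifs with hij
    · subst hij
      simp only [Pi.single_eq_same, zpow_add₀ hneg, zpow_one, mul_sub, mul_sum]
      rw [sub_eq_add_neg, ← sum_neg_distrib]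
      congr 1
      · ring
      · exact sum_congr rfl fun l _ => by ring
    · simp [hij]
  · rw [← add_sum_erase univ _ (mem_univ i), Even.neg_one_zpow (Even.add_self (k i))]
    ring
end

section
/- Let M ≥ N ≥ 1, λ > 0, η > 0, K > 0, and let A_i, Γ_i, γ_i (i = 1,...,N) be real constants, with input I(t) = Σ_{i=1}^{N} A_i·cos(Γ_i·t + γ_i). Define, for i = 1,...,N: φ_i(t) = Γ_i·t + γ_i, ω_i(t) = Γ_i/λ, α_i(t) = A_i; and for i = N+1,...,M: α_i(t) = 0, ω_i(t) = c_i for arbitrary constants c_i ∈ ℝ, and φ_i(t) = φ_i(0) + λ·c_i·t. Then F(t) := I(t) − Σ_{i=1}^{M} α_i(t)·cos(φ_i(t)) = 0 for all t, and the functions (φ_i, ω_i, α_i)_{i=1,...,M} form a solution of the pool system: φ_i'(t) = λ·ω_i(t) − K·F(t)·sin(φ_i(t)), ω_i'(t) = −K·F(t)·sin(φ_i(t)), and α_i'(t) = η·F(t)·cos(φ_i(t)) for all t and all i. In particular the system's output Σ_i α_i cos(φ_i) reproduces the periodic input exactly. -/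
open Finset

/-- Phases of the pool of `M` oscillators: the first `N` lock onto the input components,
the remaining ones rotate at their own constant frequencies `c i`. -/
noncomputable def poolPhi (N M : ℕ) (lam : ℝ) (Γ γ : Fin N → ℝ) (c φ0 : Fin M → ℝ)
    (i : Fin M) (t : ℝ) : ℝ :=
  if h : (i : ℕ) < N then Γ ⟨i, h⟩ * t + γ ⟨i, h⟩ else φ0 i + lam * c i * t

/-- Frequency variables of the pool: `Γ i / λ` for the first `N` oscillators,
arbitrary constants `c i` for the rest. -/
noncomputable def poolOmega (N M : ℕ) (lam : ℝ) (Γ : Fin N → ℝ) (c : Fin M → ℝ)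
    (i : Fin M) (_t : ℝ) : ℝ :=
  if h : (i : ℕ) < N then Γ ⟨i, h⟩ / lam else c i

/-- Amplitude variables of the pool: `A i` for the first `N` oscillators, `0` for the
rest. -/
noncomputable def poolAlpha (N M : ℕ) (A : Fin N → ℝ) (i : Fin M) (_t : ℝ) : ℝ :=
  if h : (i : ℕ) < N then A ⟨i, h⟩ else 0

/-- The feedback error `F t = I t - ∑ i α_i(t) cos (φ_i(t))` of the pool, for the input
`I t = ∑ i A_i cos (Γ_i t + γ_i)`. -/
noncomputable def poolF (N M : ℕ) (lam : ℝ) (A Γ γ : Fin N → ℝ) (c φ0 : Fin M → ℝ)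
    (t : ℝ) : ℝ :=
  (∑ i : Fin N, A i * Real.cos (Γ i * t + γ i)) -
    ∑ i : Fin M, poolAlpha N M A i t * Real.cos (poolPhi N M lam Γ γ c φ0 i t)

/-- The pool output coincides with the input, so the feedback error vanishes. -/
theorem poolF_eq_zero {N M : ℕ} (hNM : N ≤ M) (lam : ℝ) (A Γ γ : Fin N → ℝ)
    (c φ0 : Fin M → ℝ) (t : ℝ) : poolF N M lam A Γ γ c φ0 t = 0 := by
  obtain ⟨k, rfl⟩ := Nat.exists_eq_add_of_le hNM
  simp [poolF, poolAlpha, poolPhi, Fin.sum_univ_add]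

/-- Each phase of the pool rotates at the constant rate `λ ω_i`. -/
theorem hasDerivAt_poolPhi (N M : ℕ) {lam : ℝ} (hlam : lam ≠ 0) (Γ γ : Fin N → ℝ)
    (c φ0 : Fin M → ℝ) (i : Fin M) (t : ℝ) :
    HasDerivAt (poolPhi N M lam Γ γ c φ0 i) (lam * poolOmega N M lam Γ c i t) t := by
  unfold poolPhi poolOmega
  split_ifs with h
  · rw [mul_div_cancel₀ _ hlam]
    simpa using ((hasDerivAt_id t).const_mul (Γ ⟨i, h⟩)).add_const (γ ⟨i, h⟩)
  · simpa using ((hasDerivAt_id t).const_mul (lam * c i)).const_add (φ0 i)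

/-- For a periodic input `I t = ∑_{i=1}^N A_i cos (Γ_i t + γ_i)` and a
pool of `M ≥ N` adaptive frequency oscillators with amplitude adaptation coupled via a
negative mean field, setting `φ_i = Γ_i t + γ_i`, `ω_i = Γ_i/λ`, `α_i = A_i` for the
first `N` oscillators and `α_i = 0`, `ω_i = c_i`, `φ_i = φ_i(0) + λ c_i t` for the
remaining ones gives `F ≡ 0` and an exact solution of the pool dynamics
`φ_i' = λ ω_i - K F sin φ_i`, `ω_i' = -K F sin φ_i`, `α_i' = η F cos φ_i`; in
particular the output `∑ i α_i cos φ_i` reproduces the input exactly. -/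
theorem pool_exact_reconstruction_solution
    (N M : ℕ) (hN : 1 ≤ N) (hNM : N ≤ M)
    (lam η K : ℝ) (hlam : 0 < lam) (hη : 0 < η) (hK : 0 < K)
    (A Γ γ : Fin N → ℝ) (c φ0 : Fin M → ℝ) :
    (∀ t : ℝ, poolF N M lam A Γ γ c φ0 t = 0) ∧
    (∀ i : Fin M, ∀ t : ℝ,
      HasDerivAt (poolPhi N M lam Γ γ c φ0 i)
        (lam * poolOmega N M lam Γ c i t -
          K * poolF N M lam A Γ γ c φ0 t * Real.sin (poolPhi N M lam Γ γ c φ0 i t)) t ∧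
      HasDerivAt (poolOmega N M lam Γ c i)
        (-(K * poolF N M lam A Γ γ c φ0 t * Real.sin (poolPhi N M lam Γ γ c φ0 i t))) t ∧
      HasDerivAt (fun s => poolAlpha N M A i s)
        (η * poolF N M lam A Γ γ c φ0 t * Real.cos (poolPhi N M lam Γ γ c φ0 i t)) t) := by
  have hF := poolF_eq_zero hNM lam A Γ γ c φ0
  refine ⟨hF, fun i t => ?_⟩
  simp only [hF, mul_zero, zero_mul, sub_zero, neg_zero]
  exact ⟨hasDerivAt_poolPhi N M hlam.ne' Γ γ c φ0 i t, hasDerivAt_const t _,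
    hasDerivAt_const t _⟩
end
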